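/- arXiv:2112.02884 — 5 statements merged into one kernel-verified Lean document; each statement's English description precedes it below -/
import Mathlib

section
/- Threshold upper bound (Lemma 1): let r be an equilibrium threshold profile and let i be an agent with P_i ≠ ∅. Then F(r_i)^{|P_i|} ≤ c/M; equivalently, r_i ≤ F^{-1}((c/M)^{1/|P_i|}). -/
open Finset

/-- `x` leads `y` (with requester `p`): `x ≠ y` and every walk from `p` to `y` contains `x`
in its support. -/
def Leads {V : Type*} (H : SimpleGraph V) (p x y : V) : Prop :=
  x ≠ y ∧ ∀ w : H.Walk p y, x ∈ w.support

variable {V : Type*} [Fintype V] [DecidableEq V]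

/-- The agents: all vertices other than the requester `p`. -/
def agents (p : V) : Finset V := Finset.univ.filter (· ≠ p)

/-- `Dset H p i`: the set of agents led by `i`. -/
noncomputable def Dset (H : SimpleGraph V) (p i : V) : Finset V :=
  @Finset.filter _ (fun j => Leads H p i j) (Classical.decPred _) (agents p)

/-- `Pset H p i`: the competitors of `i`, namely `U \ (D_i ∪ {i})`. -/
noncomputable def Pset (H : SimpleGraph V) (p i : V) : Finset V :=
  agents p \ insert i (Dset H p i)

/-- Agent `i`'s expected utility for contributing with ability `q`:
`π_i(q) = M * ∏_{j ∈ P_i} F (max (r j) q) - c`. -/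
noncomputable def piU (H : SimpleGraph V) (p : V) (c M : ℝ) (F : ℝ → ℝ)
    (r : V → ℝ) (i : V) (q : ℝ) : ℝ :=
  M * (∏ j ∈ Pset H p i, F (max (r j) q)) - c

/-- `r` is an equilibrium threshold profile: every threshold lies in `[l,u]`, every agent has
strictly positive utility for contributing with any ability strictly above her threshold, and
each threshold is either `l` or gives nonpositive utility. -/
def IsEqm (H : SimpleGraph V) (p : V) (l u c M : ℝ) (F : ℝ → ℝ) (r : V → ℝ) : Prop :=
  (∀ i ∈ agents p, r i ∈ Set.Icc l u) ∧
  (∀ i ∈ agents p, ∀ q ∈ Set.Ioc (r i) u, 0 < piU H p c M F r i q) ∧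
  (∀ i ∈ agents p, r i = l ∨ piU H p c M F r i (r i) ≤ 0)

/-- The leader-of-mediocre probability `p_i^lom = ∏_{k ∈ D_i} F (r k)`. -/
noncomputable def lom (H : SimpleGraph V) (p : V) (F : ℝ → ℝ) (r : V → ℝ) (i : V) : ℝ :=
  ∏ k ∈ Dset H p i, F (r k)

/-- Threshold upper bound (Lemma 1): for any agent with nonempty competitor set,
`F (r i) ^ |P_i| ≤ c / M`. -/
theorem threshold_upper_bound {V : Type*} [Fintype V] [DecidableEq V]
    (H : SimpleGraph V) (p : V) (hreach : ∀ v : V, Nonempty (H.Walk p v))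
    (l u c M : ℝ) (hlu : l < u) (hc : 0 < c) (hcM : c < M)
    (F : ℝ → ℝ) (hFcont : ContinuousOn F (Set.Icc l u))
    (hFmono : StrictMonoOn F (Set.Icc l u)) (hFl : F l = 0) (hFu : F u = 1)
    (r : V → ℝ) (heqm : IsEqm H p l u c M F r)
    (i : V) (hi : i ∈ agents p) (hP : (Pset H p i).Nonempty) :
    F (r i) ^ (Pset H p i).card ≤ c / M := by
  have hM : 0 < M := hc.trans hcM
  have hri := heqm.1 i hi
  rcases heqm.2.2 i hi with h | h
  · rw [h, hFl, zero_pow hP.card_pos.ne']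
    positivity
  · rw [piU, sub_nonpos, mul_comm, ← le_div_iff₀ hM] at h
    have hnonneg : 0 ≤ F (r i) :=
      hFl ▸ hFmono.monotoneOn (Set.left_mem_Icc.2 hlu.le) hri hri.1
    calc F (r i) ^ (Pset H p i).card = ∏ _j ∈ Pset H p i, F (r i) := by
          rw [Finset.prod_const]
      _ ≤ ∏ j ∈ Pset H p i, F (max (r j) (r i)) := by
          refine Finset.prod_le_prod (fun _ _ => hnonneg) fun j hj => ?_
          have hrj := heqm.1 j (Finset.mem_sdiff.1 hj).1
          exact hFmono.monotoneOn hri ⟨le_max_of_le_left hrj.1, max_le hrj.2 hri.2⟩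
            (le_max_right _ _)
      _ ≤ c / M := h
end

section
/- Leading implies a strictly higher threshold for the led agent (Lemma 2): let r be an equilibrium threshold profile and let i, j be agents such that i leads j. Then r_i < r_j. -/
open Finset

variable {V : Type*} [Fintype V] [DecidableEq V]

theorem Leads.asymm {α : Type*} [DecidableEq α] {H : SimpleGraph α} {p x y : α}
    (hreach : Nonempty (H.Walk p y)) (h : Leads H p x y) : ¬ Leads H p y x := by
  intro h'
  obtain ⟨w⟩ := hreach
  have hx := h.2 w.bypass
  exact SimpleGraph.Walk.endpoint_notMem_support_takeUntil w.bypass_isPath hx h'.1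
    (h'.2 (w.bypass.takeUntil x hx))

theorem Leads.trans {α : Type*} [DecidableEq α] {H : SimpleGraph α} {p x y z : α}
    (hreach : Nonempty (H.Walk p y)) (h : Leads H p x y) (h' : Leads H p y z) :
    Leads H p x z := by
  refine ⟨?_, fun w => ?_⟩
  · rintro rfl
    exact h.asymm hreach h'
  · exact w.support_takeUntil_subset_support (h'.2 w) (h.2 _)

theorem mem_agents {p k : V} : k ∈ agents p ↔ k ≠ p := by
  simp [agents]

theorem mem_Pset {H : SimpleGraph V} {p i k : V} :
    k ∈ Pset H p i ↔ k ∈ agents p ∧ k ≠ i ∧ ¬ Leads H p i k := by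
  simp only [Pset, Dset, mem_sdiff, mem_insert, mem_filter]
  tauto

theorem self_notMem_Pset {H : SimpleGraph V} {p i : V} : i ∉ Pset H p i :=
  fun h => (mem_Pset.1 h).2.1 rfl

/-- A leader, together with all her competitors, competes against every agent she leads. -/
theorem Leads.insert_Pset_subset {H : SimpleGraph V} {p i j : V}
    (hreach : Nonempty (H.Walk p j)) (hi : i ∈ agents p) (h : Leads H p i j) :
    insert i (Pset H p i) ⊆ Pset H p j := by
  intro k hk
  rw [mem_Pset]
  rcases mem_insert.1 hk with rfl | hk
  · exact ⟨hi, h.1, h.asymm hreach⟩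
  · obtain ⟨hka, -, hk⟩ := mem_Pset.1 hk
    refine ⟨hka, ?_, fun hjk => hk (h.trans hreach hjk)⟩
    rintro rfl
    exact hk h

theorem continuousOn_piU {H : SimpleGraph V} {p : V} {l u c M : ℝ} {F : ℝ → ℝ} {r : V → ℝ}
    (hF : ContinuousOn F (Set.Icc l u)) (hr : ∀ k ∈ agents p, r k ∈ Set.Icc l u) (i : V) :
    ContinuousOn (piU H p c M F r i) (Set.Icc l u) := by
  refine (continuousOn_const.mul (continuousOn_finsetProd _ fun k hk => ?_)).sub
    continuousOn_const
  refine hF.comp (continuousOn_const.sup continuousOn_id) fun q hq => ?_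
  have hk := hr k (mem_Pset.1 hk).1
  exact ⟨le_max_of_le_right hq.1, max_le hk.2 hq.2⟩

theorem piU_top {H : SimpleGraph V} {p : V} {l u c M : ℝ} {F : ℝ → ℝ} {r : V → ℝ}
    (hFu : F u = 1) (hr : ∀ k ∈ agents p, r k ∈ Set.Icc l u) (i : V) :
    piU H p c M F r i u = M - c := by
  have h : ∏ k ∈ Pset H p i, F (max (r k) u) = 1 :=
    prod_eq_one fun k hk => by rw [max_eq_right (hr k (mem_Pset.1 hk).1).2, hFu]
  rw [piU, h, mul_one]

/-- At a common ability, the winning probability of a led agent is at most that of her leader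
times the factor contributed by the leader herself. -/
theorem Leads.prod_Pset_le {H : SimpleGraph V} {p i j : V} {F : ℝ → ℝ} {r : V → ℝ} {q : ℝ}
    (hreach : Nonempty (H.Walk p j)) (hi : i ∈ agents p) (h : Leads H p i j)
    (h0 : ∀ k ∈ agents p, 0 ≤ F (max (r k) q)) (h1 : ∀ k ∈ agents p, F (max (r k) q) ≤ 1) :
    ∏ k ∈ Pset H p j, F (max (r k) q) ≤
      F (max (r i) q) * ∏ k ∈ Pset H p i, F (max (r k) q) := by
  have hagents : ∀ {m k : V}, k ∈ Pset H p m → k ∈ agents p := fun hk => (mem_Pset.1 hk).1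
  rw [← prod_sdiff (h.insert_Pset_subset hreach hi), prod_insert self_notMem_Pset]
  refine mul_le_of_le_one_left
    (mul_nonneg (h0 i hi) (prod_nonneg fun k hk => h0 k (hagents hk))) ?_
  exact prod_le_one (fun k hk => h0 k (hagents (mem_sdiff.1 hk).1))
    fun k hk => h1 k (hagents (mem_sdiff.1 hk).1)

/-- Leading implies a strictly higher threshold for the led agent (Lemma 2). -/
theorem led_agent_higher_threshold {V : Type*} [Fintype V] [DecidableEq V]
    (H : SimpleGraph V) (p : V) (hreach : ∀ v : V, Nonempty (H.Walk p v))
    (l u c M : ℝ) (hlu : l < u) (hc : 0 < c) (hcM : c < M)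
    (F : ℝ → ℝ) (hFcont : ContinuousOn F (Set.Icc l u))
    (hFmono : StrictMonoOn F (Set.Icc l u)) (hFl : F l = 0) (hFu : F u = 1)
    (r : V → ℝ) (heqm : IsEqm H p l u c M F r)
    (i j : V) (hi : i ∈ agents p) (hj : j ∈ agents p) (hlead : Leads H p i j) :
    r i < r j := by
  obtain ⟨hr, hpos, hthr⟩ := heqm
  by_contra! hji
  have hri := hr i hi
  have hriu : r i < u := by
    refine lt_of_le_of_ne hri.2 fun h => ?_
    rcases hthr i hi with h' | h'
    · linarith
    · rw [h, piU_top hFu hr] at h'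
      linarith
  have hnonneg : 0 ≤ piU H p c M F r j (r i) := by
    have hcont := (continuousOn_piU (H := H) (c := c) (M := M) hFcont hr j (r i) hri).mono
      (Set.Ioc_subset_Icc_self.trans (Set.Icc_subset_Icc_left hri.1) : Set.Ioc (r i) u ⊆ _)
    have : (nhdsWithin (r i) (Set.Ioc (r i) u)).NeBot := by
      rw [nhdsWithin_Ioc_eq_nhdsGT hriu]
      infer_instance
    refine ge_of_tendsto hcont ?_
    filter_upwards [self_mem_nhdsWithin] with q hq
    exact (hpos j hj q ⟨hji.trans_lt hq.1, hq.2⟩).le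
  have hmem : ∀ k ∈ agents p, max (r k) (r i) ∈ Set.Icc l u := fun k hk =>
    ⟨le_max_of_le_right hri.1, max_le (hr k hk).2 hri.2⟩
  have h0 : ∀ k ∈ agents p, 0 ≤ F (max (r k) (r i)) := fun k hk =>
    hFl ▸ hFmono.monotoneOn (Set.left_mem_Icc.2 hlu.le) (hmem k hk) (hmem k hk).1
  have h1 : ∀ k ∈ agents p, F (max (r k) (r i)) ≤ 1 := fun k hk =>
    hFu ▸ hFmono.monotoneOn (hmem k hk) (Set.right_mem_Icc.2 hlu.le) (hmem k hk).2
  have hle := hlead.prod_Pset_le (hreach j) hi h0 h1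
  rw [max_self] at hle
  have hM : 0 < M := hc.trans hcM
  have hF1 : F (r i) < 1 := hFu ▸ hFmono hri (Set.right_mem_Icc.2 hlu.le) hriu
  have hprod := mul_le_mul_of_nonneg_left hle hM.le
  rw [piU] at hnonneg
  rcases hthr i hi with h | h
  · rw [h, hFl, zero_mul, mul_zero, ← h] at hprod
    linarith
  · rw [piU] at h
    have hP : 0 ≤ ∏ k ∈ Pset H p i, F (max (r k) (r i)) :=
      prod_nonneg fun k hk => h0 k (mem_Pset.1 hk).1
    rcases hP.eq_or_lt with hP | hP
    · rw [← hP, mul_zero, mul_zero] at hprod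
      linarith
    · have hlt := mul_lt_mul_of_pos_right hF1 (mul_pos hM hP)
      linarith [mul_left_comm M (F (r i)) (∏ k ∈ Pset H p i, F (max (r k) (r i)))]
end

section
/- Leaf agents have the identical, highest threshold (Proposition 3): let r be an equilibrium threshold profile and suppose |U| ≥ 2. Then every leaf agent z satisfies M · F(r_z)^{|U|−1} = c (equivalently r_z = F^{-1}((c/M)^{1/(|U|−1)})); any two leaf agents have equal thresholds; and for every agent i and every leaf agent z, r_i ≤ r_z. -/
open Finset

variable {V : Type*} [Fintype V] [DecidableEq V]

theorem Pset_eq_erase_of_Dset_eq_empty {H : SimpleGraph V} {p z : V} (h : Dset H p z = ∅) :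
    Pset H p z = (agents p).erase z := by
  rw [Pset, h, insert_empty_eq, Finset.sdiff_singleton_eq_erase]

theorem card_Pset_le {H : SimpleGraph V} {p i : V} (hi : i ∈ agents p) :
    (Pset H p i).card ≤ (agents p).card - 1 := by
  rw [← Finset.card_erase_of_mem hi]
  refine Finset.card_le_card fun j hj => ?_
  simp only [Pset, Finset.mem_sdiff, Finset.mem_insert, not_or] at hj
  exact Finset.mem_erase.2 ⟨hj.2.1, hj.1⟩

theorem mem_agents_of_mem_Pset {H : SimpleGraph V} {p i j : V} (hj : j ∈ Pset H p i) :
    j ∈ agents p :=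
  (Finset.mem_sdiff.1 hj).1

theorem piU_eq_of_forall_le {H : SimpleGraph V} {p : V} {c M : ℝ} {F : ℝ → ℝ} {r : V → ℝ}
    {i : V} {q : ℝ} (h : ∀ j ∈ agents p, r j ≤ q) :
    piU H p c M F r i q = M * F q ^ (Pset H p i).card - c := by
  rw [piU, Finset.prod_congr rfl
    fun j hj => by rw [max_eq_right (h j (mem_agents_of_mem_Pset hj))], Finset.prod_const]

theorem card_Pset_of_Dset_eq_empty {H : SimpleGraph V} {p z : V} (hz : z ∈ agents p)
    (h : Dset H p z = ∅) : (Pset H p z).card = (agents p).card - 1 := by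
  rw [Pset_eq_erase_of_Dset_eq_empty h, Finset.card_erase_of_mem hz]

theorem IsEqm.le_leaf {H : SimpleGraph V} {p : V} {l u c M : ℝ} {F : ℝ → ℝ} {r : V → ℝ}
    (heqm : IsEqm H p l u c M F r) (hlu : l ≤ u) (hM : 0 ≤ M)
    (hFmono : MonotoneOn F (Set.Icc l u)) (hFl : F l = 0) (hFu : F u = 1)
    {i z : V} (hi : i ∈ agents p) (hz : z ∈ agents p) (hleaf : Dset H p z = ∅) :
    r i ≤ r z := by
  obtain ⟨hmem, hpos, hthr⟩ := heqm
  obtain ⟨k, hk, hmax⟩ := (agents p).exists_max_image r ⟨z, hz⟩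
  refine (hmax i hi).trans ?_
  by_contra! hlt
  have hkl : r k ≠ l := ((hmem z hz).1.trans_lt hlt).ne'
  have hle := (hthr k hk).resolve_left hkl
  have hgt := hpos z hz (r k) ⟨hlt, (hmem k hk).2⟩
  rw [piU_eq_of_forall_le hmax] at hle hgt
  rw [card_Pset_of_Dset_eq_empty hz hleaf] at hgt
  have hF0 : 0 ≤ F (r k) :=
    hFl ▸ hFmono (Set.left_mem_Icc.2 hlu) (hmem k hk) (hmem k hk).1
  have hF1 : F (r k) ≤ 1 :=
    hFu ▸ hFmono (hmem k hk) (Set.right_mem_Icc.2 hlu) (hmem k hk).2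
  have := mul_le_mul_of_nonneg_left
    (pow_le_pow_of_le_one hF0 hF1 (card_Pset_le (H := H) hk)) hM
  linarith

theorem IsEqm.mul_pow_leaf_eq {H : SimpleGraph V} {p : V} {l u c M : ℝ} {F : ℝ → ℝ} {r : V → ℝ}
    (heqm : IsEqm H p l u c M F r) (hc : 0 ≤ c) (hcM : c ≤ M)
    (hFcont : ContinuousOn F (Set.Icc l u)) (hFl : F l = 0) (hFu : F u = 1)
    (hcard : 2 ≤ (agents p).card) {z : V} (hz : z ∈ agents p) (hleaf : Dset H p z = ∅)
    (hmax : ∀ j ∈ agents p, r j ≤ r z) :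
    M * F (r z) ^ ((agents p).card - 1) = c := by
  obtain ⟨hmem, hpos, hthr⟩ := heqm
  have hpi : ∀ q, r z ≤ q → piU H p c M F r z q = M * F q ^ ((agents p).card - 1) - c :=
    fun q hq => by
      rw [piU_eq_of_forall_le fun j hj => (hmax j hj).trans hq,
        card_Pset_of_Dset_eq_empty hz hleaf]
  apply le_antisymm
  · rcases hthr z hz with h | h
    · rw [h, hFl, zero_pow (by omega), mul_zero]
      exact hc
    · rw [hpi _ le_rfl] at h
      linarith
  · rcases (hmem z hz).2.eq_or_lt with h | h
    · rw [h, hFu, one_pow, mul_one]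
      exact hcM
    · have hcont : ContinuousWithinAt (fun q => M * F q ^ ((agents p).card - 1))
          (Set.Ioc (r z) u) (r z) :=
        (((hFcont (r z) (hmem z hz)).pow _).const_mul M).mono fun q hq =>
          ⟨(hmem z hz).1.trans hq.1.le, hq.2⟩
      have : (nhdsWithin (r z) (Set.Ioc (r z) u)).NeBot := by
        rw [← mem_closure_iff_nhdsWithin_neBot, closure_Ioc h.ne]
        exact Set.left_mem_Icc.2 h.le
      refine ge_of_tendsto hcont (eventually_nhdsWithin_of_forall fun q hq => ?_)
      have hq' := hpos z hz q hq
      rw [hpi q hq.1.le] at hq'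
      linarith

/-- Leaf agents have the identical, highest threshold (Proposition 3): every leaf agent
`z` satisfies `M * F (r z) ^ (|U| - 1) = c`, any two leaf agents have equal thresholds, and
every agent'\''s threshold is at most that of any leaf agent. -/
theorem leaf_agents_highest_threshold {V : Type*} [Fintype V] [DecidableEq V]
    (H : SimpleGraph V) (p : V) (hreach : ∀ v : V, Nonempty (H.Walk p v))
    (l u c M : ℝ) (hlu : l < u) (hc : 0 < c) (hcM : c < M)
    (F : ℝ → ℝ) (hFcont : ContinuousOn F (Set.Icc l u))
    (hFmono : StrictMonoOn F (Set.Icc l u)) (hFl : F l = 0) (hFu : F u = 1)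
    (r : V → ℝ) (heqm : IsEqm H p l u c M F r)
    (hcard : 2 ≤ (agents p).card) :
    (∀ z ∈ agents p, Dset H p z = ∅ → M * F (r z) ^ ((agents p).card - 1) = c) ∧
    (∀ z ∈ agents p, ∀ z' ∈ agents p, Dset H p z = ∅ → Dset H p z' = ∅ → r z = r z') ∧
    (∀ i ∈ agents p, ∀ z ∈ agents p, Dset H p z = ∅ → r i ≤ r z) := by
  have hM : 0 ≤ M := (hc.trans hcM).le
  have hle : ∀ i ∈ agents p, ∀ z ∈ agents p, Dset H p z = ∅ → r i ≤ r z :=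
    fun i hi z hz hleaf => heqm.le_leaf hlu.le hM hFmono.monotoneOn hFl hFu hi hz hleaf
  exact ⟨fun z hz hleaf => heqm.mul_pow_leaf_eq hc.le hcM.le hFcont hFl hFu hcard hz hleaf
      fun j hj => hle j hj z hz hleaf,
    fun z hz z' hz' hleaf hleaf' => (hle z hz z' hz' hleaf').antisymm (hle z' hz' z hz hleaf),
    hle⟩
end

section
/- Inviting neighbours strictly decreases an agent's threshold (Lemma 3): let r be an equilibrium threshold profile, and let i be an agent with D_i ≠ ∅ such that there exists a leaf agent z ∈ P_i. Let n = |U \ D_i| (the number of agents that would remain if i invited no one, in which case i would be a leaf with threshold F^{-1}((c/M)^{1/(n−1)})). Then F(r_i)^{n−1} < c/M; that is, i's equilibrium threshold is strictly below the leaf threshold of the reduced contest with n agents. -/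
open Finset

variable {V : Type*} [Fintype V] [DecidableEq V]

theorem Dset_subset_agents (H : SimpleGraph V) (p i : V) : Dset H p i ⊆ agents p :=
  @Finset.filter_subset _ _ (Classical.decPred _) _

theorem notMem_Dset_self (H : SimpleGraph V) (p i : V) : i ∉ Dset H p i := fun h =>
  ((@Finset.mem_filter _ _ (Classical.decPred _) _ _).1 h).2.1 rfl

theorem Pset_eq_erase (H : SimpleGraph V) (p i : V) :
    Pset H p i = (agents p \ Dset H p i).erase i := by
  rw [Pset, Finset.sdiff_insert]

/-- An agent never refuses to contribute with the maximal ability, so thresholds lie below `u`. -/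
theorem IsEqm.threshold_lt {H : SimpleGraph V} {p : V} {l u c M : ℝ} {F : ℝ → ℝ} {r : V → ℝ}
    (heqm : IsEqm H p l u c M F r) (hlu : l < u) (hcM : c < M) (hFu : F u = 1)
    {k : V} (hk : k ∈ agents p) : r k < u := by
  refine lt_of_le_of_ne (heqm.1 k hk).2 fun hku => ?_
  rcases heqm.2.2 k hk with h | h
  · exact hlu.ne (h.symm.trans hku)
  · have hprod : ∏ j ∈ Pset H p k, F (max (r j) u) = 1 := by
      refine Finset.prod_eq_one fun j hj => ?_
      rw [max_eq_right (heqm.1 j (Finset.mem_sdiff.1 hj).1).2, hFu]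
    rw [piU, hku, hprod] at h
    linarith

/-- By continuity, utility is nonnegative at every ability in `[r z, u)`. -/
theorem IsEqm.piU_nonneg {H : SimpleGraph V} {p : V} {l u c M : ℝ} {F : ℝ → ℝ} {r : V → ℝ}
    (heqm : IsEqm H p l u c M F r) (hFcont : ContinuousOn F (Set.Icc l u))
    {z : V} (hz : z ∈ agents p) {q : ℝ} (hrq : r z ≤ q) (hqu : q < u) :
    0 ≤ piU H p c M F r z q := by
  have hlq : l ≤ q := (heqm.1 z hz).1.trans hrq
  have hcont : ContinuousOn (piU H p c M F r z) (Set.Icc l u) := by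
    refine (continuousOn_const.mul (continuousOn_finsetProd _ fun j hj => ?_)).sub
      continuousOn_const
    have hj' := heqm.1 j (Finset.mem_sdiff.1 hj).1
    exact hFcont.comp (by fun_prop) fun x hx => ⟨hx.1.trans (le_max_right _ _),
      max_le hj'.2 hx.2⟩
  have htend : Filter.Tendsto (piU H p c M F r z) (nhdsWithin q (Set.Ioc q u))
      (nhds (piU H p c M F r z q)) :=
    (hcont q ⟨hlq, hqu.le⟩).mono fun x hx => ⟨hlq.trans hx.1.le, hx.2⟩
  have : (nhdsWithin q (Set.Ioc q u)).NeBot := by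
    rw [nhdsWithin_Ioc_eq_nhdsGT hqu]
    infer_instance
  exact ge_of_tendsto htend (Filter.mem_of_superset self_mem_nhdsWithin
    fun x hx => (heqm.2.1 z hz x ⟨hrq.trans_lt hx.1, hx.2⟩).le)

/-- Inviting neighbours strictly decreases an agent'\''s threshold (Lemma 3): if `D_i ≠ ∅`
and some competitor of `i` is a leaf, then with `n = |U \ D_i|` one has
`F (r i) ^ (n - 1) < c / M`. -/
theorem inviting_decreases_threshold {V : Type*} [Fintype V] [DecidableEq V]
    (H : SimpleGraph V) (p : V) (hreach : ∀ v : V, Nonempty (H.Walk p v))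
    (l u c M : ℝ) (hlu : l < u) (hc : 0 < c) (hcM : c < M)
    (F : ℝ → ℝ) (hFcont : ContinuousOn F (Set.Icc l u))
    (hFmono : StrictMonoOn F (Set.Icc l u)) (hFl : F l = 0) (hFu : F u = 1)
    (r : V → ℝ) (heqm : IsEqm H p l u c M F r)
    (i : V) (hi : i ∈ agents p) (hD : (Dset H p i).Nonempty)
    (hz : ∃ z ∈ Pset H p i, Dset H p z = ∅) :
    F (r i) ^ ((agents p \ Dset H p i).card - 1) < c / M := by
  have hM : 0 < M := hc.trans hcM
  have hri := heqm.1 i hi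
  have hcard : (agents p \ Dset H p i).card - 1 = (Pset H p i).card := by
    rw [Pset_eq_erase, Finset.card_erase_of_mem
      (Finset.mem_sdiff.2 ⟨hi, notMem_Dset_self H p i⟩)]
  rw [hcard]
  obtain ⟨z, hzP, hzD⟩ := hz
  by_cases hil : r i = l
  · rw [hil, hFl, zero_pow (Finset.card_ne_zero_of_mem hzP)]
    exact div_pos hc hM
  have hle := (heqm.2.2 i hi).resolve_left hil
  have hFi : 0 < F (r i) := by
    rw [← hFl]
    exact hFmono ⟨le_rfl, hlu.le⟩ hri (lt_of_le_of_ne hri.1 (Ne.symm hil))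
  have hmem : ∀ j ∈ agents p, max (r j) (r i) ∈ Set.Icc l u := fun j hj =>
    ⟨hri.1.trans (le_max_right _ _), max_le (heqm.1 j hj).2 hri.2⟩
  have hFmax : ∀ j ∈ agents p, F (r i) ≤ F (max (r j) (r i)) := fun j hj =>
    hFmono.monotoneOn hri (hmem j hj) (le_max_right _ _)
  have hagents : ∀ j ∈ Pset H p i, j ∈ agents p := fun j hj => (Finset.mem_sdiff.1 hj).1
  have hprod : ∏ j ∈ Pset H p i, F (max (r j) (r i)) ≤ c / M := by
    rw [le_div_iff₀' hM]
    exact sub_nonpos.1 hle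
  rw [← Finset.prod_const]
  by_cases hex : ∃ j ∈ Pset H p i, r i < r j
  · obtain ⟨j, hj, hij⟩ := hex
    refine (Finset.prod_lt_prod (fun _ _ => hFi) (fun k hk => hFmax k (hagents k hk))
      ⟨j, hj, ?_⟩).trans_le hprod
    exact hFmono hri (hmem j (hagents j hj)) (lt_max_of_lt_left hij)
  push Not at hex
  have hzA := hagents z hzP
  have hz0 := heqm.piU_nonneg hFcont hzA (hex z hzP) (heqm.threshold_lt hlu hcM hFu hi)
  have hDlt : ∏ k ∈ Dset H p i, F (max (r k) (r i)) < 1 := by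
    have hlt : ∀ k ∈ Dset H p i, F (max (r k) (r i)) < 1 := fun k hk => by
      have hk' := Dset_subset_agents H p i hk
      rw [← hFu]
      exact hFmono (hmem k hk') ⟨hlu.le, le_rfl⟩ (max_lt
        (heqm.threshold_lt hlu hcM hFu hk') (heqm.threshold_lt hlu hcM hFu hi))
    simpa using Finset.prod_lt_prod_of_nonempty (g := fun _ => (1 : ℝ))
      (fun k hk => hFi.trans_le (hFmax k (Dset_subset_agents H p i hk))) hlt hD
  have hzprod : ∏ j ∈ Pset H p z, F (max (r j) (r i)) =
      (∏ _j ∈ Pset H p i, F (r i)) * ∏ k ∈ Dset H p i, F (max (r k) (r i)) := by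
    apply mul_left_cancel₀ hFi.ne'
    have hP : ∏ j ∈ Pset H p i, F (max (r j) (r i)) = ∏ _j ∈ Pset H p i, F (r i) :=
      Finset.prod_congr rfl fun j hj => by rw [max_eq_right (hex j hj)]
    have h₁ := Finset.mul_prod_erase (agents p) (fun j => F (max (r j) (r i))) hzA
    have h₂ := Finset.mul_prod_erase (agents p \ Dset H p i) (fun j => F (max (r j) (r i)))
      (Finset.mem_sdiff.2 ⟨hi, notMem_Dset_self H p i⟩)
    have h₃ := Finset.prod_sdiff (f := fun j => F (max (r j) (r i)))
      (Dset_subset_agents H p i)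
    rw [← Pset_eq_erase, hP] at h₂
    simp only [max_eq_right (hex z hzP), max_self] at h₁ h₂
    rw [Pset_eq_erase H p z, hzD, Finset.sdiff_empty, h₁, ← h₃, ← h₂, mul_assoc]
  rw [piU, hzprod, sub_nonneg, ← div_le_iff₀' hM] at hz0
  have hpos : 0 < ∏ _j ∈ Pset H p i, F (r i) := Finset.prod_pos fun _ _ => hFi
  have hub : ∏ _j ∈ Pset H p i, F (r i) ≤ c / M :=
    (Finset.prod_le_prod (fun _ _ => hFi.le) fun k hk => hFmax k (hagents k hk)).trans hprod
  exact absurd (hz0.trans_lt (mul_lt_of_lt_one_right hpos hDlt)) hub.not_gt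
end

section
/- Unique minimum threshold lies at the lower bound (Lemma on minimum thresholds, part 1): let r be an equilibrium threshold profile with |U| ≥ 2, and suppose there is an agent i such that r_i < r_j for every agent j ≠ i (a unique agent with the lowest threshold). Then r_i = l; that is, i is an unconditional contributor. -/
open Finset

variable {V : Type*} [Fintype V] [DecidableEq V]

/-- Unique minimum threshold lies at the lower bound: if agent `i` has a strictly lowest
threshold among at least two agents, then `r i = l` (she is an unconditional contributor). -/
theorem unique_min_threshold_eq_lower_bound {V : Type*} [Fintype V] [DecidableEq V]
    (H : SimpleGraph V) (p : V) (hreach : ∀ v : V, Nonempty (H.Walk p v))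
    (l u c M : ℝ) (hlu : l < u) (hc : 0 < c) (hcM : c < M)
    (F : ℝ → ℝ) (hFcont : ContinuousOn F (Set.Icc l u))
    (hFmono : StrictMonoOn F (Set.Icc l u)) (hFl : F l = 0) (hFu : F u = 1)
    (r : V → ℝ) (heqm : IsEqm H p l u c M F r)
    (hcard : 2 ≤ (agents p).card) (i : V) (hi : i ∈ agents p)
    (hmin : ∀ j ∈ agents p, j ≠ i → r i < r j) :
    r i = l := by
  obtain ⟨hIcc, hpos, hnonpos⟩ := heqm
  refine (hnonpos i hi).resolve_right fun hle => ?_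
  have hne : ((agents p).erase i).Nonempty := by
    rw [← Finset.card_pos, Finset.card_erase_of_mem hi]
    omega
  obtain ⟨k, hk, hkmin⟩ := Finset.exists_min_image _ r hne
  obtain ⟨hki, hka⟩ := Finset.mem_erase.1 hk
  have hik : r i < r k := hmin k hka hki
  refine absurd (hpos i hi (r k) ⟨hik, (hIcc k hka).2⟩) (not_lt.2 ?_)
  suffices h : piU H p c M F r i (r k) = piU H p c M F r i (r i) from h.trans_le hle
  unfold piU
  congr 2
  refine Finset.prod_congr rfl fun j hj => ?_
  obtain ⟨hja, hj⟩ := Finset.mem_sdiff.1 hj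
  have hji : j ≠ i := fun h => hj (h ▸ Finset.mem_insert_self _ _)
  rw [max_eq_left (hkmin j (Finset.mem_erase.2 ⟨hji, hja⟩)), max_eq_left (hmin j hja hji).le]
end
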